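/- arXiv:1508.00964 — 7 statements merged into one kernel-verified Lean document; each statement's English description precedes it below -/
import Mathlib

section
/- Let M ≥ 1 and let a, b ∈ ℝ^M be independent random vectors, each with entries that are i.i.d. Gaussian with mean 0 and variance 1/M (i.e., (a,b) is distributed according to the product of 2M copies of N(0, 1/M)). Then the pushforward of this measure under the map (a,b) ↦ ⟨a,b⟩/‖a‖₂ (defined arbitrarily, e.g. as 0, on the null set where a = 0) is the Gaussian measure N(0, 1/M) on ℝ. -/
open MeasureTheory ProbabilityTheory Real
open scoped NNReal ENNReal

lemma aux_unit (M : ℕ) (v : ℝ≥0) (c : Fin M → ℝ) (hc : ∑ m, c m ^ 2 = 1) :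
    Measure.map (fun b : Fin M → ℝ => ∑ m, c m * b m)
      (Measure.pi fun _ : Fin M => gaussianReal 0 v) = gaussianReal 0 v := by
  have : IsProbabilityMeasure (Measure.map (fun b : Fin M → ℝ => ∑ m, c m * b m)
      (Measure.pi fun _ : Fin M => gaussianReal 0 v)) :=
    Measure.isProbabilityMeasure_map (Measurable.aemeasurable (by fun_prop))
  apply Measure.ext_of_charFun
  ext t
  rw [charFun_apply_real, integral_map (Measurable.aemeasurable (by fun_prop)) (by fun_prop)]
  have h1 : ∀ b : Fin M → ℝ, Complex.exp (t * ((∑ m, c m * b m : ℝ) : ℂ) * Complex.I)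
      = ∏ m, Complex.exp (((t * c m : ℝ) : ℂ) * (b m : ℂ) * Complex.I) := by
    intro b
    rw [← Complex.exp_sum]
    congr 1
    push_cast
    rw [Finset.mul_sum, Finset.sum_mul]
    exact Finset.sum_congr rfl fun m _ => by ring
  simp_rw [h1]
  rw [integral_fintype_prod_eq_prod (𝕜 := ℂ)
    (fun m (x : ℝ) => Complex.exp (((t * c m : ℝ) : ℂ) * (x : ℂ) * Complex.I))]
  simp_rw [← charFun_apply_real, charFun_gaussianReal]
  rw [← Complex.exp_sum]
  congr 1
  have h2 : ∑ m, ((c m : ℂ)) ^ 2 = 1 := by exact_mod_cast hc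
  calc _ = ∑ m, (-(v * t ^ 2 / 2 : ℂ)) * (c m : ℂ) ^ 2 :=
        Finset.sum_congr rfl fun m _ => by push_cast; ring
    _ = _ := by rw [← Finset.mul_sum, h2]; push_cast; ring

/-- The inner product of two independent random vectors with i.i.d. `N(0, 1/M)` entries,
normalized by the norm of the first, is distributed as `N(0, 1/M)`. -/
theorem stmt0 (M : ℕ) (hM : 1 ≤ M)
    (μ : Measure (Fin M → ℝ))
    (hμ : μ = Measure.pi fun _ : Fin M => gaussianReal 0 ((M : ℝ≥0))⁻¹) :
    Measure.map
      (fun p : (Fin M → ℝ) × (Fin M → ℝ) =>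
        (∑ m, p.1 m * p.2 m) / Real.sqrt (∑ m, (p.1 m) ^ 2))
      (μ.prod μ)
      = gaussianReal 0 ((M : ℝ≥0))⁻¹ := by
  have hv : ((M : ℝ≥0))⁻¹ ≠ 0 := by
    have : (M : ℝ≥0) ≠ 0 := by exact_mod_cast (by omega : M ≠ 0)
    exact inv_ne_zero this
  have := nullSingletonClass_gaussianReal (μ := 0) hv
  have : IsProbabilityMeasure μ := by rw [hμ]; infer_instance
  have : NullSingletonClass μ := by rw [hμ]; exact Measure.pi_nullSingletonClass ⟨0, hM⟩
  have hmeas : Measurable (fun p : (Fin M → ℝ) × (Fin M → ℝ) =>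
        (∑ m, p.1 m * p.2 m) / Real.sqrt (∑ m, (p.1 m) ^ 2)) := by fun_prop
  ext s hs
  rw [Measure.map_apply hmeas hs, Measure.prod_apply (hmeas hs)]
  have hae : ∀ᵐ a ∂μ, a ≠ 0 := by
    simp [ae_iff]
  rw [lintegral_congr_ae (g := fun _ => gaussianReal 0 ((M : ℝ≥0))⁻¹ s)]
  · simp
  filter_upwards [hae] with a ha
  have hpos : 0 < ∑ m, a m ^ 2 := by
    obtain ⟨i, hi⟩ := Function.ne_iff.mp ha
    exact Finset.sum_pos' (fun m _ => sq_nonneg _) ⟨i, Finset.mem_univ _, by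
      have : a i ≠ 0 := hi
      positivity⟩
  have hc : ∑ m, (a m / Real.sqrt (∑ m, a m ^ 2)) ^ 2 = 1 := by
    simp_rw [div_pow, Real.sq_sqrt hpos.le]
    rw [← Finset.sum_div, div_self hpos.ne']
  rw [← aux_unit M _ _ hc, Measure.map_apply (by fun_prop) hs, ← hμ]
  congr 1
  ext b
  simp only [Set.mem_preimage]
  rw [Finset.sum_div]
  simp_rw [div_mul_eq_mul_div]
end

section
/- Let σ₀ > 0, σ₁ > 0, and λ ∈ (0, 1). Then ∫_ℝ (1/(√(2π)·σ₀))·e^{−t²/(2σ₀²)}·exp(λ·(t²/(2σ₀²) − (t−1)²/(2σ₁²))) dt = exp(−λ(1−λ)/(2λ(σ₀²−σ₁²)+2σ₁²)) / (σ₀·√((1−λ)/σ₀² + λ/σ₁²)). (This evaluates E[e^{λ g(Z)}] for Z ~ N(0, σ₀²) and g(t) = t²/(2σ₀²) − (t−1)²/(2σ₁²).) -/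
open MeasureTheory Real

/-- The Chernoff moment `E[e^{l g(Z)}]` for `Z ~ N(0, σ₀²)` and
`g(t) = t²/(2σ₀²) − (t−1)²/(2σ₁²)`, evaluated in closed form. -/
theorem stmt10 (σ₀ σ₁ l : ℝ) (hσ₀ : 0 < σ₀) (hσ₁ : 0 < σ₁) (hl₀ : 0 < l) (hl₁ : l < 1) :
    ∫ t : ℝ, (1 / (Real.sqrt (2 * π) * σ₀)) * Real.exp (-t ^ 2 / (2 * σ₀ ^ 2))
        * Real.exp (l * (t ^ 2 / (2 * σ₀ ^ 2) - (t - 1) ^ 2 / (2 * σ₁ ^ 2)))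
      = Real.exp (-(l * (1 - l)) / (2 * l * (σ₀ ^ 2 - σ₁ ^ 2) + 2 * σ₁ ^ 2))
          / (σ₀ * Real.sqrt ((1 - l) / σ₀ ^ 2 + l / σ₁ ^ 2)) := by
  have hD : 0 < l * σ₀ ^ 2 + (1 - l) * σ₁ ^ 2 := by
    have : 0 < 1 - l := by linarith
    positivity
  obtain ⟨D, hDd⟩ : ∃ D, D = l * σ₀ ^ 2 + (1 - l) * σ₁ ^ 2 := ⟨_, rfl⟩
  rw [← hDd] at hD
  have hA : (1 - l) / σ₀ ^ 2 + l / σ₁ ^ 2 = D / (σ₀ ^ 2 * σ₁ ^ 2) := by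
    rw [hDd]; field_simp; ring
  have hE : 2 * l * (σ₀ ^ 2 - σ₁ ^ 2) + 2 * σ₁ ^ 2 = 2 * D := by rw [hDd]; ring
  rw [hA, hE]
  have key : ∀ t : ℝ, (1 / (Real.sqrt (2 * π) * σ₀)) * Real.exp (-t ^ 2 / (2 * σ₀ ^ 2))
        * Real.exp (l * (t ^ 2 / (2 * σ₀ ^ 2) - (t - 1) ^ 2 / (2 * σ₁ ^ 2)))
      = (1 / (Real.sqrt (2 * π) * σ₀) * Real.exp (-(l * (1 - l)) / (2 * D))) *
        Real.exp (-(D / (σ₀ ^ 2 * σ₁ ^ 2) / 2) * (t - l * σ₀ ^ 2 / D) ^ 2) := by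
    intro t
    rw [mul_assoc, mul_assoc, ← Real.exp_add, ← Real.exp_add]
    congr 2
    field_simp
    rw [hDd]
    ring
  simp_rw [key]
  rw [integral_const_mul,
    integral_sub_right_eq_self (fun t : ℝ => Real.exp (-(D / (σ₀ ^ 2 * σ₁ ^ 2) / 2) * t ^ 2)),
    integral_gaussian]
  have hB : 0 < D / (σ₀ ^ 2 * σ₁ ^ 2) := by positivity
  have h1 : π / (D / (σ₀ ^ 2 * σ₁ ^ 2) / 2) = (2 * π) / (D / (σ₀ ^ 2 * σ₁ ^ 2)) := by
    field_simp
  rw [h1, Real.sqrt_div (by positivity)]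
  have h2 : 0 < Real.sqrt (2 * π) := by positivity
  have h3 := Real.sqrt_pos.mpr hB
  generalize Real.sqrt (D / (σ₀ ^ 2 * σ₁ ^ 2)) = r at *
  generalize Real.sqrt (2 * π) = q at *
  field_simp
end

section
/- Let σ₀ > 0, σ₁ > 0, and λ ∈ (0, 1). Then ∫_ℝ (1/(√(2π)·σ₁))·e^{−(t−1)²/(2σ₁²)}·exp(−λ·(t²/(2σ₀²) − (t−1)²/(2σ₁²))) dt = exp(λ(1−λ)/(2λ(σ₀²−σ₁²)−2σ₀²)) / (σ₁·√(λ/σ₀² + (1−λ)/σ₁²)). (This evaluates E[e^{−λ g(Z)}] for Z ~ N(1, σ₁²) and g(t) = t²/(2σ₀²) − (t−1)²/(2σ₁²).) -/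
open MeasureTheory Real

/-- The Chernoff moment `E[e^{−λ g(Z)}]` for `Z ~ N(1, σ₁²)` and
`g(t) = t²/(2σ₀²) − (t−1)²/(2σ₁²)`, evaluated in closed form. -/
theorem stmt11 (σ₀ σ₁ l : ℝ) (hσ₀ : 0 < σ₀) (hσ₁ : 0 < σ₁) (hl₀ : 0 < l) (hl₁ : l < 1) :
    ∫ t : ℝ, (1 / (Real.sqrt (2 * π) * σ₁)) * Real.exp (-(t - 1) ^ 2 / (2 * σ₁ ^ 2))
        * Real.exp (-(l * (t ^ 2 / (2 * σ₀ ^ 2) - (t - 1) ^ 2 / (2 * σ₁ ^ 2))))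
      = Real.exp ((l * (1 - l)) / (2 * l * (σ₀ ^ 2 - σ₁ ^ 2) - 2 * σ₀ ^ 2))
          / (σ₁ * Real.sqrt (l / σ₀ ^ 2 + (1 - l) / σ₁ ^ 2)) := by
  have hl : 0 < 1 - l := by linarith
  have hD : 0 < (1 - l) * σ₀ ^ 2 + l * σ₁ ^ 2 := by positivity
  have hE : 2 * l * (σ₀ ^ 2 - σ₁ ^ 2) - 2 * σ₀ ^ 2 = -(2 * ((1 - l) * σ₀ ^ 2 + l * σ₁ ^ 2)) := by
    ring
  rw [hE]
  set a := l / σ₀ ^ 2 + (1 - l) / σ₁ ^ 2 with ha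
  have hapos : 0 < a := by positivity
  obtain ⟨D, hDD⟩ : ∃ D, D = (1 - l) * σ₀ ^ 2 + l * σ₁ ^ 2 := ⟨_, rfl⟩
  rw [← hDD] at hD ⊢
  have key : ∀ t : ℝ, (1 / (Real.sqrt (2 * π) * σ₁)) * Real.exp (-(t - 1) ^ 2 / (2 * σ₁ ^ 2))
        * Real.exp (-(l * (t ^ 2 / (2 * σ₀ ^ 2) - (t - 1) ^ 2 / (2 * σ₁ ^ 2))))
      = (1 / (Real.sqrt (2 * π) * σ₁) * Real.exp ((l * (1 - l)) / (-(2 * D))))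
        * Real.exp (-(a / 2) * (t - (1 - l) * σ₀ ^ 2 / D) ^ 2) := by
    intro t
    rw [mul_assoc, mul_assoc, ← Real.exp_add, ← Real.exp_add]
    congr 2
    have ha2 : a = D / (σ₀ ^ 2 * σ₁ ^ 2) := by
      rw [ha, hDD]; field_simp; ring
    rw [ha2]
    field_simp
    rw [hDD]
    ring
  simp_rw [key]
  rw [integral_const_mul,
    integral_sub_right_eq_self (fun x : ℝ => Real.exp (-(a / 2) * x ^ 2)), integral_gaussian]
  have h1 : π / (a / 2) = 2 * π / a := by field_simp
  rw [h1, Real.sqrt_div (by positivity)]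
  have h2 : 0 < Real.sqrt (2 * π) := by positivity
  have h3 : 0 < Real.sqrt a := by positivity
  field_simp
end

section
/- Let σ₀ > 0 and σ₁ > 0, let Z₀ and Z₁ be independent real random variables with Z₀ ~ N(0, σ₀²) and Z₁ ~ N(1, σ₁²), and define g(t) = t²/(2σ₀²) − (t−1)²/(2σ₁²). Then P[g(Z₀) > g(Z₁)] ≤ exp(−1/(2(σ₀²+σ₁²))) / ((1/2)·(σ₁/σ₀ + σ₀/σ₁)). -/
open MeasureTheory ProbabilityTheory Real
open scoped NNReal ENNReal

lemma aux_gauss (s v μ m c : ℝ) (hs : 0 < s) (hv : 0 < v) (f : ℝ → ℝ)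
    (hf : Measurable f)
    (h : ∀ t, -(t - μ) ^ 2 / (2 * s) + f t = -(t - m) ^ 2 / (2 * v) + c) :
    ∫⁻ t, ENNReal.ofReal (Real.exp (f t)) ∂(gaussianReal μ s.toNNReal)
      = ENNReal.ofReal ((√(2 * π * s))⁻¹ * √(2 * π * v) * Real.exp c) := by
  have hs' : s.toNNReal ≠ 0 := by simpa using hs
  have hv' : v.toNNReal ≠ 0 := by simpa using hv
  rw [gaussianReal_of_var_ne_zero _ hs',
    lintegral_withDensity_eq_lintegral_mul _ (measurable_gaussianPDF _ _) (by fun_prop)]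
  have key : ∀ t, (gaussianPDF μ s.toNNReal * fun t => ENNReal.ofReal (Real.exp (f t))) t
      = ENNReal.ofReal ((√(2 * π * s))⁻¹ * √(2 * π * v) * Real.exp c)
        * gaussianPDF m v.toNNReal t := by
    intro t
    simp only [Pi.mul_apply, gaussianPDF]
    rw [← ENNReal.ofReal_mul (gaussianPDFReal_nonneg _ _ _), ← ENNReal.ofReal_mul (by positivity)]
    congr 1
    simp only [gaussianPDFReal, Real.coe_toNNReal _ hs.le, Real.coe_toNNReal _ hv.le]
    rw [mul_assoc, ← Real.exp_add, h t, Real.exp_add]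
    have : √(2 * π * v) ≠ 0 := by positivity
    field_simp
  rw [lintegral_congr key, lintegral_const_mul _ (measurable_gaussianPDF _ _),
    lintegral_gaussianPDF_eq_one _ hv', mul_one]

/-- For independent `Z₀ ~ N(0, σ₀²)` and `Z₁ ~ N(1, σ₁²)` and
`g(t) = t²/(2σ₀²) − (t−1)²/(2σ₁²)`,
`P[g(Z₀) > g(Z₁)] ≤ exp(−1/(2(σ₀²+σ₁²))) / ((1/2)(σ₁/σ₀ + σ₀/σ₁))`. -/
theorem stmt12 (σ₀ σ₁ : ℝ) (hσ₀ : 0 < σ₀) (hσ₁ : 0 < σ₁)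
    (g : ℝ → ℝ) (hg : ∀ t, g t = t ^ 2 / (2 * σ₀ ^ 2) - (t - 1) ^ 2 / (2 * σ₁ ^ 2)) :
    ((gaussianReal 0 ((σ₀ ^ 2).toNNReal)).prod (gaussianReal 1 ((σ₁ ^ 2).toNNReal)))
        {p : ℝ × ℝ | g p.1 > g p.2}
      ≤ ENNReal.ofReal
          (Real.exp (-1 / (2 * (σ₀ ^ 2 + σ₁ ^ 2)))
            / ((1 / 2) * (σ₁ / σ₀ + σ₀ / σ₁))) := by
  have hgm : Measurable g := by
    have : g = fun t => t ^ 2 / (2 * σ₀ ^ 2) - (t - 1) ^ 2 / (2 * σ₁ ^ 2) := funext hg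
    rw [this]; fun_prop
  have hS : MeasurableSet {p : ℝ × ℝ | g p.1 > g p.2} :=
    measurableSet_lt (hgm.comp measurable_snd) (hgm.comp measurable_fst)
  have hsum : 0 < σ₀ ^ 2 + σ₁ ^ 2 := by positivity
  have hv : 0 < 2 * σ₀ ^ 2 * σ₁ ^ 2 / (σ₀ ^ 2 + σ₁ ^ 2) := by positivity
  have h0 := aux_gauss (σ₀ ^ 2) (2 * σ₀ ^ 2 * σ₁ ^ 2 / (σ₀ ^ 2 + σ₁ ^ 2)) 0
    (σ₀ ^ 2 / (σ₀ ^ 2 + σ₁ ^ 2)) (-1 / (4 * (σ₀ ^ 2 + σ₁ ^ 2))) (by positivity) hv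
    (fun t => g t / 2) (by fun_prop) (by intro t; simp only [hg]; field_simp; ring)
  have h1 := aux_gauss (σ₁ ^ 2) (2 * σ₀ ^ 2 * σ₁ ^ 2 / (σ₀ ^ 2 + σ₁ ^ 2)) 1
    (σ₀ ^ 2 / (σ₀ ^ 2 + σ₁ ^ 2)) (-1 / (4 * (σ₀ ^ 2 + σ₁ ^ 2))) (by positivity) hv
    (fun t => -g t / 2) (by fun_prop) (by intro t; simp only [hg]; field_simp; ring)
  calc _ = ∫⁻ p, Set.indicator {p : ℝ × ℝ | g p.1 > g p.2} 1 p
        ∂((gaussianReal 0 ((σ₀ ^ 2).toNNReal)).prod (gaussianReal 1 ((σ₁ ^ 2).toNNReal))) :=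
        (lintegral_indicator_one hS).symm
    _ ≤ ∫⁻ p, ENNReal.ofReal (Real.exp (g p.1 / 2)) * ENNReal.ofReal (Real.exp (-g p.2 / 2))
        ∂((gaussianReal 0 ((σ₀ ^ 2).toNNReal)).prod (gaussianReal 1 ((σ₁ ^ 2).toNNReal))) := by
        apply lintegral_mono
        intro p
        apply Set.indicator_le' (s := {p : ℝ × ℝ | g p.1 > g p.2}) _ _ p
        · intro p hp
          have hp' : g p.1 > g p.2 := hp
          rw [← ENNReal.ofReal_mul (by positivity), ← Real.exp_add]
          simp only [Pi.one_apply]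
          rw [ENNReal.one_le_ofReal]
          apply Real.one_le_exp
          linarith
        · intro p _
          exact zero_le
    _ = _ := by
        rw [lintegral_prod_mul (f := fun t => ENNReal.ofReal (Real.exp (g t / 2)))
          (g := fun t => ENNReal.ofReal (Real.exp (-g t / 2))) (by fun_prop) (by fun_prop), h0, h1,
          ← ENNReal.ofReal_mul (by positivity)]
        congr 1
        have e : Real.exp (-1 / (2 * (σ₀ ^ 2 + σ₁ ^ 2)))
            = Real.exp (-1 / (4 * (σ₀ ^ 2 + σ₁ ^ 2))) * Real.exp (-1 / (4 * (σ₀ ^ 2 + σ₁ ^ 2))) := by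
          rw [← Real.exp_add]; congr 1; field_simp; norm_num
        rw [e, Real.sqrt_mul (by positivity) (σ₀ ^ 2), Real.sqrt_mul (by positivity) (σ₁ ^ 2),
          Real.sqrt_sq hσ₀.le, Real.sqrt_sq hσ₁.le]
        generalize Real.exp (-1 / (4 * (σ₀ ^ 2 + σ₁ ^ 2))) = E
        have hw := Real.mul_self_sqrt
          (show 0 ≤ 2 * π * (2 * σ₀ ^ 2 * σ₁ ^ 2 / (σ₀ ^ 2 + σ₁ ^ 2)) by positivity)
        have hp := Real.mul_self_sqrt (show 0 ≤ 2 * π by positivity)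
        have hq : √(2 * π) ≠ 0 := by positivity
        generalize √(2 * π * (2 * σ₀ ^ 2 * σ₁ ^ 2 / (σ₀ ^ 2 + σ₁ ^ 2))) = w at *
        generalize √(2 * π) = q at *
        calc _ = (w * w) / ((q * q) * (σ₀ * σ₁)) * (E * E) := by field_simp
          _ = _ := by rw [hw, hp]; field_simp; ring
end

section
/- Let M ≥ 1 and K, k be natural numbers with k ≤ K, let v ≥ 0 be a real number with K − k + v > 0, and set σ₀² = (K − k + 1 + v)/M and σ₁² = (K − k + v)/M. Let Z₀ and Z₁ be independent with Z₀ ~ N(0, σ₀²) and Z₁ ~ N(1, σ₁²), and define g(t) = t²/(2σ₀²) − (t−1)²/(2σ₁²). Then P[g(Z₀) > g(Z₁)] ≤ exp(−M/(2(2K − 2k + 2v + 1))). -/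
open MeasureTheory ProbabilityTheory Real
open scoped NNReal ENNReal

lemma key_pointwise (s t x y : ℝ) (hs : 0 < s) (ht : 0 < t)
    (h : y ^ 2 / (2 * s) - (y - 1) ^ 2 / (2 * t) < x ^ 2 / (2 * s) - (x - 1) ^ 2 / (2 * t)) :
    gaussianPDFReal 0 s.toNNReal x * gaussianPDFReal 1 t.toNNReal y ≤
      Real.exp (-1 / (2 * (s + t))) *
        (gaussianPDFReal (s / (s + t)) (2 * s * t / (s + t)).toNNReal x *
         gaussianPDFReal (s / (s + t)) (2 * s * t / (s + t)).toNNReal y) := by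
  have hw : 0 < 2 * s * t / (s + t) := by positivity
  simp only [gaussianPDFReal, Real.coe_toNNReal _ hs.le, Real.coe_toNNReal _ ht.le,
    Real.coe_toNNReal _ hw.le]
  set w := 2 * s * t / (s + t) with hwdef
  set m := s / (s + t) with hm
  have hid : ∀ z : ℝ, z ^ 2 / (4 * s) + (z - 1) ^ 2 / (4 * t)
      = (z - m) ^ 2 / (2 * w) + 1 / (4 * (s + t)) := by
    intro z
    rw [hwdef, hm]
    field_simp
    ring
  have hexp : -(x - 0) ^ 2 / (2 * s) + -(y - 1) ^ 2 / (2 * t) ≤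
      -1 / (2 * (s + t)) + (-(x - m) ^ 2 / (2 * w) + -(y - m) ^ 2 / (2 * w)) := by
    have h1 := hid x
    have h2 := hid y
    have e : ∀ a b : ℝ, a / (4 * b) = (a / (2 * b)) / 2 := by
      intro a b
      rw [div_div]; congr 1; ring
    simp only [e] at h1 h2
    simp only [neg_div, sub_zero]
    linarith
  have hconst : (√(2 * π * s))⁻¹ * (√(2 * π * t))⁻¹ ≤ (√(2 * π * w))⁻¹ * (√(2 * π * w))⁻¹ := by
    rw [← mul_inv, ← mul_inv, Real.mul_self_sqrt (by positivity),
      ← Real.sqrt_mul (by positivity)]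
    apply inv_anti₀ (by positivity)
    apply Real.le_sqrt_of_sq_le
    have hw2 : w ^ 2 ≤ s * t := by
      rw [hwdef, div_pow, div_le_iff₀ (by positivity)]
      nlinarith [mul_nonneg (mul_pos hs ht).le (sq_nonneg (s - t))]
    have := mul_le_mul_of_nonneg_left hw2 (by positivity : 0 ≤ (2 * π) ^ 2)
    nlinarith
  have := mul_le_mul hconst (Real.exp_le_exp.mpr hexp) (Real.exp_pos _).le (by positivity)
  rw [Real.exp_add, Real.exp_add, Real.exp_add] at this
  calc _ = _ := by ring
    _ ≤ _ := this
    _ = _ := by ring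

/-- Error-probability bound in the `k`-th iteration of MAP-MP: with
`σ₀² = (K − k + 1 + v)/M`, `σ₁² = (K − k + v)/M`, independent `Z₀ ~ N(0, σ₀²)`,
`Z₁ ~ N(1, σ₁²)` and `g(t) = t²/(2σ₀²) − (t−1)²/(2σ₁²)`,
`P[g(Z₀) > g(Z₁)] ≤ exp(−M/(2(2K − 2k + 2v + 1)))`. -/
theorem stmt13 (M K k : ℕ) (hM : 1 ≤ M) (hk : k ≤ K)
    (v : ℝ) (hv : 0 ≤ v) (hKkv : 0 < (K : ℝ) - k + v)
    (s₀ s₁ : ℝ)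
    (hs₀ : s₀ = ((K : ℝ) - k + 1 + v) / M) (hs₁ : s₁ = ((K : ℝ) - k + v) / M)
    (g : ℝ → ℝ)
    (hg : ∀ t, g t = t ^ 2 / (2 * s₀) - (t - 1) ^ 2 / (2 * s₁)) :
    ((gaussianReal 0 s₀.toNNReal).prod (gaussianReal 1 s₁.toNNReal))
        {p : ℝ × ℝ | g p.1 > g p.2}
      ≤ ENNReal.ofReal
          (Real.exp (-(M : ℝ) / (2 * (2 * (K : ℝ) - 2 * k + 2 * v + 1)))) := by
  have hMpos : (0 : ℝ) < M := by exact_mod_cast hM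
  have h0 : 0 < s₀ := by rw [hs₀]; apply div_pos _ hMpos; linarith
  have h1 : 0 < s₁ := by rw [hs₁]; exact div_pos hKkv hMpos
  have hE : -(M : ℝ) / (2 * (2 * (K : ℝ) - 2 * k + 2 * v + 1)) = -1 / (2 * (s₀ + s₁)) := by
    have hne : (2 * (K : ℝ) - 2 * k + 2 * v + 1) ≠ 0 := by linarith
    have : s₀ + s₁ = (2 * (K : ℝ) - 2 * k + 2 * v + 1) / M := by
      rw [hs₀, hs₁, ← add_div]; congr 1; ring
    rw [this]
    field_simp
  rw [hE]
  have hw : 0 < 2 * s₀ * s₁ / (s₀ + s₁) := by positivity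
  have key := fun x y => key_pointwise s₀ s₁ x y h0 h1
  set w := (2 * s₀ * s₁ / (s₀ + s₁)).toNNReal with hwdef
  set m := s₀ / (s₀ + s₁)
  have hw0 : w ≠ 0 := by simpa [hwdef] using hw
  have h0' : s₀.toNNReal ≠ 0 := by simpa using h0
  have h1' : s₁.toNNReal ≠ 0 := by simpa using h1
  have hgm : Measurable g := by
    have : g = fun t => t ^ 2 / (2 * s₀) - (t - 1) ^ 2 / (2 * s₁) := funext hg
    rw [this]; fun_prop
  have hS : MeasurableSet {p : ℝ × ℝ | g p.1 > g p.2} :=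
    measurableSet_lt (hgm.comp measurable_snd) (hgm.comp measurable_fst)
  have hone : ∫⁻ p : ℝ × ℝ, gaussianPDF m w p.1 * gaussianPDF m w p.2 = 1 := by
    rw [Measure.volume_eq_prod, lintegral_prod_mul (by fun_prop) (by fun_prop),
      lintegral_gaussianPDF_eq_one _ hw0, one_mul]
  rw [gaussianReal_of_var_ne_zero _ h0', gaussianReal_of_var_ne_zero _ h1',
    prod_withDensity (by fun_prop) (by fun_prop), withDensity_apply _ hS]
  calc _ ≤ ∫⁻ p in {p : ℝ × ℝ | g p.1 > g p.2}, ENNReal.ofReal (Real.exp (-1 / (2 * (s₀ + s₁)))) *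
            (gaussianPDF m w p.1 * gaussianPDF m w p.2) ∂(volume.prod volume) := by
        apply setLIntegral_mono' hS
        intro p hp
        simp only [Set.mem_setOf_eq, gt_iff_lt, hg] at hp
        simp only [gaussianPDF]
        rw [← ENNReal.ofReal_mul (gaussianPDFReal_nonneg _ _ _),
          ← ENNReal.ofReal_mul (gaussianPDFReal_nonneg _ _ _),
          ← ENNReal.ofReal_mul (Real.exp_pos _).le]
        exact ENNReal.ofReal_le_ofReal (key _ _ hp)
    _ ≤ ∫⁻ p : ℝ × ℝ, ENNReal.ofReal (Real.exp (-1 / (2 * (s₀ + s₁)))) *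
            (gaussianPDF m w p.1 * gaussianPDF m w p.2) := setLIntegral_le_lintegral _ _
    _ = _ := by
        rw [lintegral_const_mul _ (by fun_prop), hone, mul_one]
end

section
/- Let M ≥ 1 and k ≥ 1, let A be a real M×k matrix such that AᵀA is invertible, fix an index i ∈ {1,…,k}, let b ∈ ℝ^M be the i-th column of A, and let A_i be the M×(k−1) matrix obtained by deleting the i-th column of A. Assume A_iᵀA_i is invertible, and let P⊥ = I − A_i(A_iᵀA_i)⁻¹A_iᵀ be the orthogonal projection onto the orthogonal complement of the column space of A_i. Then the i-th diagonal entry of (AᵀA)⁻¹ equals 1/(bᵀ P⊥ b). -/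
open Matrix

/-- The `i`-th diagonal entry of `(AᵀA)⁻¹` equals `1/(bᵀ P⊥ b)`, where `b` is the `i`-th
column of `A`, `A_i` is `A` with its `i`-th column deleted, and
`P⊥ = I − A_i(A_iᵀA_i)⁻¹A_iᵀ` is the orthogonal projection onto the orthogonal
complement of the column space of `A_i`. -/
theorem stmt18 (M k : ℕ) (hM : 1 ≤ M) (hk : 1 ≤ k)
    (A : Matrix (Fin M) (Fin k) ℝ) (hA : IsUnit (Aᵀ * A))
    (i : Fin k)
    (b : Fin M → ℝ) (hb : b = fun m => A m i)
    (Ai : Matrix (Fin M) {j : Fin k // j ≠ i} ℝ)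
    (hAi : Ai = fun m j => A m j.1)
    (hAiInv : IsUnit (Aiᵀ * Ai))
    (Pperp : Matrix (Fin M) (Fin M) ℝ)
    (hP : Pperp = 1 - Ai * (Aiᵀ * Ai)⁻¹ * Aiᵀ) :
    (Aᵀ * A)⁻¹ i i = 1 / (b ⬝ᵥ (Pperp *ᵥ b)) := by
  have hdet : IsUnit (Aᵀ * A).det := (Matrix.isUnit_iff_isUnit_det _).1 hA
  have hdet2 : IsUnit (Aiᵀ * Ai).det := (Matrix.isUnit_iff_isUnit_det _).1 hAiInv
  obtain ⟨x, hx⟩ : ∃ x, x = (Aᵀ * A)⁻¹ *ᵥ Pi.single i (1 : ℝ) := ⟨_, rfl⟩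
  have hxi : (Aᵀ * A)⁻¹ i i = x i := by
    rw [hx]; simp
  have hv : Aᵀ *ᵥ (A *ᵥ x) = Pi.single i (1 : ℝ) := by
    rw [hx, Matrix.mulVec_mulVec, Matrix.mulVec_mulVec, Matrix.mul_nonsing_inv _ hdet,
      Matrix.one_mulVec]
  have hsplit : A *ᵥ x = x i • b + Ai *ᵥ (fun j => x j.1) := by
    ext m
    simp only [Matrix.mulVec, dotProduct, Pi.add_apply, Pi.smul_apply, smul_eq_mul, hb, hAi]
    rw [Fintype.sum_eq_add_sum_subtype_ne _ i, mul_comm]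
  have h1 : b ⬝ᵥ (A *ᵥ x) = 1 := by
    have := congrFun hv i
    rw [Pi.single_eq_same] at this
    rw [← this, hb]; rfl
  have h2 : Aiᵀ *ᵥ (A *ᵥ x) = 0 := by
    ext j
    have := congrFun hv j.1
    rw [Pi.single_eq_of_ne j.2] at this
    rw [Pi.zero_apply, ← this, hAi]; rfl
  have hPA : Pperp * Ai = 0 := by
    rw [hP, Matrix.sub_mul, Matrix.one_mul, Matrix.mul_assoc, Matrix.mul_assoc,
      Matrix.nonsing_inv_mul _ hdet2, Matrix.mul_one, sub_self]
  have hPv : Pperp *ᵥ (A *ᵥ x) = A *ᵥ x := by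
    rw [hP, Matrix.sub_mulVec, Matrix.one_mulVec, ← Matrix.mulVec_mulVec _ _ Aiᵀ, h2,
      Matrix.mulVec_zero, sub_zero]
  have h3 : A *ᵥ x = x i • (Pperp *ᵥ b) := by
    rw [← hPv, hsplit, Matrix.mulVec_add, Matrix.mulVec_mulVec, hPA, Matrix.zero_mulVec,
      add_zero, Matrix.mulVec_smul]
  rw [h3, dotProduct_smul, smul_eq_mul] at h1
  rw [hxi]
  exact eq_one_div_of_mul_eq_one_left h1
end

section
/- Let M ≥ 1, k ≥ 0, p ≥ 0 be natural numbers, let A be a real M×k matrix with AᵀA invertible, and set P = (AᵀA)⁻¹Aᵀ. Let σₓ ≥ 0 and σ_w ≥ 0, and let B (an M×p random matrix with i.i.d. N(0, 1/M) entries), x (a random vector in ℝ^p with i.i.d. N(0, σₓ²) entries), and w (a random vector in ℝ^M with i.i.d. N(0, σ_w²) entries) be mutually independent, i.e., distributed according to the product of all the corresponding Gaussian measures. Let e = P(Bx + w) ∈ ℝ^k. Then for all indices i, j ∈ {1,…,k}, E[e_i · e_j] = (p·σₓ²/M + σ_w²) · ((AᵀA)⁻¹)_{ij}; in matrix form, E[e·eᵀ]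 = (σₓ²·p/M + σ_w²)·(AᵀA)⁻¹. -/
open MeasureTheory ProbabilityTheory Matrix
open scoped NNReal ENNReal

/-- f is integrable with integral c -/
def JJ {Ω : Type*} [MeasurableSpace Ω] (μ : Measure Ω) (f : Ω → ℝ) (c : ℝ) : Prop :=
  Integrable f μ ∧ ∫ ω, f ω ∂μ = c

lemma JJ.add {Ω : Type*} [MeasurableSpace Ω] {μ : Measure Ω} {f g : Ω → ℝ} {c d : ℝ}
    (hf : JJ μ f c) (hg : JJ μ g d) : JJ μ (fun ω => f ω + g ω) (c + d) :=
  ⟨hf.1.add hg.1, by rw [integral_add hf.1 hg.1, hf.2, hg.2]⟩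

lemma JJ.const_mul {Ω : Type*} [MeasurableSpace Ω] {μ : Measure Ω} {f : Ω → ℝ} {c : ℝ}
    (hf : JJ μ f c) (r : ℝ) : JJ μ (fun ω => r * f ω) (r * c) :=
  ⟨hf.1.const_mul r, by rw [integral_const_mul, hf.2]⟩

lemma JJ.sum {Ω ι : Type*} [Fintype ι] [MeasurableSpace Ω] {μ : Measure Ω} {f : ι → Ω → ℝ}
    {c : ι → ℝ} (hf : ∀ i, JJ μ (f i) (c i)) : JJ μ (fun ω => ∑ i, f i ω) (∑ i, c i) :=
  ⟨integrable_finset_sum _ fun i _ => (hf i).1, by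
    rw [integral_finset_sum _ fun i _ => (hf i).1]
    exact Finset.sum_congr rfl fun i _ => (hf i).2⟩

lemma JJ.prod {Ω Ω' : Type*} [MeasurableSpace Ω] [MeasurableSpace Ω'] {μ : Measure Ω}
    {ν : Measure Ω'} [SFinite μ] [SFinite ν] {f : Ω → ℝ} {g : Ω' → ℝ} {c d : ℝ}
    (hf : JJ μ f c) (hg : JJ ν g d) : JJ (μ.prod ν) (fun ω => f ω.1 * g ω.2) (c * d) :=
  ⟨hf.1.mul_prod hg.1, by rw [integral_prod_mul, hf.2, hg.2]⟩

lemma JJ.one {Ω : Type*} [MeasurableSpace Ω] (μ : Measure Ω) [IsProbabilityMeasure μ] :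
    JJ μ (fun _ => 1) 1 := ⟨integrable_const _, by simp⟩

lemma JJ.eval {Ω ι : Type*} [Fintype ι] [MeasurableSpace Ω] {ν : Measure Ω}
    [IsProbabilityMeasure ν] {f : Ω → ℝ} {c : ℝ} (hf : JJ ν f c) (i : ι) :
    JJ (Measure.pi fun _ : ι => ν) (fun z => f (z i)) c :=
  ⟨(measurePreserving_eval (fun _ : ι => ν) i).integrable_comp_of_integrable hf.1, by
    rw [← hf.2]
    exact integral_comp_eval (μ := fun _ : ι => ν) (i := i) hf.1.aestronglyMeasurable⟩

lemma JJ.eval2 {Ω ι : Type*} [Fintype ι] [DecidableEq ι] [MeasurableSpace Ω] {ν : Measure Ω}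
    [IsProbabilityMeasure ν] {f g : Ω → ℝ} {c : ℝ} (hf : JJ ν f 0) (hg : JJ ν g 0)
    (hfg : JJ ν (fun ω => f ω * g ω) c) (i j : ι) :
    JJ (Measure.pi fun _ : ι => ν) (fun z => f (z i) * g (z j)) (if i = j then c else 0) := by
  split_ifs with h
  · subst h
    exact hfg.eval i
  · have hi := hf.eval (ι := ι) i
    have hj := hg.eval (ι := ι) j
    have hind : IndepFun (fun z : ι → Ω => f (z i)) (fun z : ι → Ω => g (z j))
        (Measure.pi fun _ : ι => ν) := by
      have h0 : IndepFun (fun z : ι → Ω => z i) (fun z : ι → Ω => z j)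
        (Measure.pi fun _ : ι => ν) :=
        (iIndepFun_pi (μ := fun _ : ι => ν) (X := fun _ => id)
          (fun _ => aemeasurable_id)).indepFun h
      have e1 := (measurePreserving_eval (fun _ : ι => ν) i).map_eq
      have e2 := (measurePreserving_eval (fun _ : ι => ν) j).map_eq
      refine h0.comp₀ (φ := f) (ψ := g) (measurable_pi_apply i).aemeasurable
        (measurable_pi_apply j).aemeasurable ?_ ?_
      · rw [show (fun z : ι → Ω => z i) = Function.eval i from rfl, e1]
        exact hf.1.aemeasurable
      · rw [show (fun z : ι → Ω => z j) = Function.eval j from rfl, e2]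
        exact hg.1.aemeasurable
    refine ⟨hind.integrable_mul hi.1 hj.1, ?_⟩
    have := hind.integral_mul_eq_mul_integral hi.1.aestronglyMeasurable hj.1.aestronglyMeasurable
    rw [hi.2, hj.2, mul_zero] at this
    exact this

lemma JJ_gauss (v : ℝ≥0) : JJ (gaussianReal 0 v) (fun x => x) 0 :=
  ⟨(memLp_id_gaussianReal 1).integrable (by simp), integral_id_gaussianReal⟩

lemma JJ_gauss2 (v : ℝ≥0) : JJ (gaussianReal 0 v) (fun x => x * x) v := by
  have h : MemLp id 2 (gaussianReal 0 v) := memLp_id_gaussianReal 2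
  refine ⟨h.integrable_mul h, ?_⟩
  have h2 := variance_fun_id_gaussianReal (μ := 0) (v := v)
  rw [variance_of_integral_eq_zero aemeasurable_id' integral_id_gaussianReal] at h2
  rw [← h2]
  simp [pow_two]

lemma JJ_pi2 {ι : Type*} [Fintype ι] [DecidableEq ι] (v : ℝ≥0) (i j : ι) :
    JJ (Measure.pi fun _ : ι => gaussianReal 0 v) (fun z => z i * z j)
      (if i = j then (v : ℝ) else 0) :=
  JJ.eval2 (JJ_gauss v) (JJ_gauss v) (JJ_gauss2 v) i j

lemma JJ_pi1 {ι : Type*} [Fintype ι] (v : ℝ≥0) (i : ι) :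
    JJ (Measure.pi fun _ : ι => gaussianReal 0 v) (fun z => z i) 0 :=
  JJ.eval (JJ_gauss v) i

lemma JJ_Y {M p : ℕ} (u v s : ℝ≥0) (m n : Fin M) :
    JJ ((Measure.pi fun _ : Fin M => Measure.pi fun _ : Fin p => gaussianReal 0 u).prod
        ((Measure.pi fun _ : Fin p => gaussianReal 0 v).prod
          (Measure.pi fun _ : Fin M => gaussianReal 0 s)))
      (fun ω => (∑ a, ω.1 m a * ω.2.1 a + ω.2.2 m) * (∑ a, ω.1 n a * ω.2.1 a + ω.2.2 n))
      (if m = n then (p * (u * v) + s : ℝ) else 0) := by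
  have B1 : ∀ (m : Fin M) (a : Fin p), JJ (Measure.pi fun _ : Fin M =>
      Measure.pi fun _ : Fin p => gaussianReal 0 u) (fun B => B m a) 0 :=
    fun m a => JJ.eval (JJ_pi1 u a) m
  have B2 : ∀ (m n : Fin M) (a b : Fin p), JJ (Measure.pi fun _ : Fin M =>
      Measure.pi fun _ : Fin p => gaussianReal 0 u) (fun B => B m a * B n b)
      (if m = n then (if a = b then (u : ℝ) else 0) else 0) :=
    fun m n a b => JJ.eval2 (JJ_pi1 u a) (JJ_pi1 u b) (JJ_pi2 u a b) m n
  have T1 := JJ.sum fun a : Fin p => JJ.sum fun b : Fin p =>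
    (B2 m n a b).prod ((JJ_pi2 v a b).prod (JJ.one (Measure.pi fun _ : Fin M => gaussianReal 0 s)))
  have T2 := JJ.sum fun a : Fin p => (B1 m a).prod ((JJ_pi1 v a).prod (JJ_pi1 s n))
  have T3 := JJ.sum fun a : Fin p => (B1 n a).prod ((JJ_pi1 v a).prod (JJ_pi1 s m))
  have T4 := (JJ.one (Measure.pi fun _ : Fin M => Measure.pi fun _ : Fin p => gaussianReal 0 u)).prod
    ((JJ.one (Measure.pi fun _ : Fin p => gaussianReal 0 v)).prod (JJ_pi2 s m n))
  convert ((T1.add T2).add T3).add T4 using 1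
  · funext ω
    rw [add_mul, mul_add, mul_add, Finset.sum_mul_sum, Finset.sum_mul, Finset.mul_sum]
    have h1 : ∀ a b : Fin p, ω.1 m a * ω.2.1 a * (ω.1 n b * ω.2.1 b)
      = ω.1 m a * ω.1 n b * (ω.2.1 a * ω.2.1 b * 1) := fun a b => by ring
    have h2 : ∀ a : Fin p, ω.1 m a * ω.2.1 a * ω.2.2 n
      = ω.1 m a * (ω.2.1 a * ω.2.2 n) := fun a => by ring
    have h3 : ∀ a : Fin p, ω.2.2 m * (ω.1 n a * ω.2.1 a)
      = ω.1 n a * (ω.2.1 a * ω.2.2 m) := fun a => by ring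
    simp only [h1, h2, h3]
    ring
  · split_ifs with h <;> simp

/-- Error covariance of the least-squares estimate (Lemma 4, conditional form): with
`P = (AᵀA)⁻¹Aᵀ`, a random matrix `B` with i.i.d. `N(0, 1/M)` entries, a random signal
`x` with i.i.d. `N(0, σₓ²)` entries and noise `w` with i.i.d. `N(0, σ_w²)` entries, all
mutually independent, the error `e = P(Bx + w)` satisfies
`E[eᵢ eⱼ] = (p σₓ²/M + σ_w²) ((AᵀA)⁻¹)ᵢⱼ`. -/
theorem stmt19 (Mdim k p : ℕ) (hM : 1 ≤ Mdim)
    (A : Matrix (Fin Mdim) (Fin k) ℝ) (hA : IsUnit (Aᵀ * A))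
    (P : Matrix (Fin k) (Fin Mdim) ℝ) (hP : P = (Aᵀ * A)⁻¹ * Aᵀ)
    (σx σw : ℝ) (hσx : 0 ≤ σx) (hσw : 0 ≤ σw)
    (μ : Measure ((Fin Mdim → Fin p → ℝ) × (Fin p → ℝ) × (Fin Mdim → ℝ)))
    (hμ : μ =
      (Measure.pi fun _ : Fin Mdim =>
          Measure.pi fun _ : Fin p => gaussianReal 0 ((Mdim : ℝ≥0))⁻¹).prod
        ((Measure.pi fun _ : Fin p => gaussianReal 0 ((σx ^ 2).toNNReal)).prod
          (Measure.pi fun _ : Fin Mdim => gaussianReal 0 ((σw ^ 2).toNNReal))))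
    (e : ((Fin Mdim → Fin p → ℝ) × (Fin p → ℝ) × (Fin Mdim → ℝ)) → Fin k → ℝ)
    (he : ∀ ω, e ω = P *ᵥ ((Matrix.of ω.1) *ᵥ ω.2.1 + ω.2.2)) :
    ∀ i j : Fin k,
      ∫ ω, e ω i * e ω j ∂μ
        = ((p : ℝ) * σx ^ 2 / Mdim + σw ^ 2) * (Aᵀ * A)⁻¹ i j := by
  intro i j
  have hMr : (Mdim : ℝ) ≠ 0 := by positivity
  have key := JJ.sum fun m => JJ.sum fun n =>
    (JJ_Y (p := p) ((Mdim : ℝ≥0))⁻¹ ((σx ^ 2).toNNReal) ((σw ^ 2).toNNReal) m n).const_mul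
      (P i m * P j n)
  rw [← hμ] at key
  have hPP : P * Pᵀ = (Aᵀ * A)⁻¹ := by
    have hd : IsUnit (Aᵀ * A).det := (Matrix.isUnit_iff_isUnit_det _).1 hA
    rw [hP, transpose_mul, transpose_transpose, transpose_nonsing_inv, transpose_mul,
      transpose_transpose, Matrix.mul_assoc, ← Matrix.mul_assoc Aᵀ,
      Matrix.mul_nonsing_inv _ hd, Matrix.mul_one]
  have hee : ∀ ω, e ω i * e ω j = ∑ m, ∑ n, P i m * P j n *
      ((∑ a, ω.1 m a * ω.2.1 a + ω.2.2 m) * (∑ a, ω.1 n a * ω.2.1 a + ω.2.2 n)) := by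
    intro ω
    rw [he]
    simp only [mulVec, dotProduct, Pi.add_apply, of_apply]
    rw [Finset.sum_mul_sum]
    exact Finset.sum_congr rfl fun m _ => Finset.sum_congr rfl fun n _ => by ring
  simp only [hee]
  rw [key.2, ← hPP, Matrix.mul_apply, Finset.mul_sum]
  refine Finset.sum_congr rfl fun m _ => ?_
  simp only [mul_ite, mul_zero, Finset.sum_ite_eq, Finset.mem_univ, if_true, transpose_apply,
    NNReal.coe_inv, NNReal.coe_natCast, Real.coe_toNNReal _ (sq_nonneg _)]
  field_simp
end
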